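/- With V, H, F as for the 2-D Navier–Stokes equation and A the Stokes operator with viscosity ν > 0 (⟨Au, u⟩ = −ν‖u‖_V²), for all u, v ∈ V: ⟨Au + F(u) − Av − F(v), u − v⟩_{V*,V} ≤ −(ν/2)‖u − v‖_V² + (32/ν³)‖v‖_{L⁴(Λ;ℝ²)}⁴ ‖u − v‖_H². -/

import Mathlib

open MeasureTheory

/-- The trilinear form `b(u,v,w) = ∫ ∑ᵢⱼ uⁱ (Dᵢ vʲ) wʲ dx`;
`⟨F(u,v), w⟩_{V*,V} = -b(u,v,w)` where `F(u,v) = -P_H[(u·∇)v]`. -/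
noncomputable def nsTrilinear (d : ℕ)
    (u v w : EuclideanSpace ℝ (Fin d) → EuclideanSpace ℝ (Fin d)) : ℝ :=
  ∫ x, ∑ i, ∑ j, u x i * fderiv ℝ v x (EuclideanSpace.single i 1) j * w x j

/-- The squared (Frobenius) norm of the Jacobian, `|∇v|²(x) = ∑ᵢⱼ (Dᵢ vʲ)²`. -/
noncomputable def gradSq (d : ℕ)
    (v : EuclideanSpace ℝ (Fin d) → EuclideanSpace ℝ (Fin d))
    (x : EuclideanSpace ℝ (Fin d)) : ℝ :=
  ∑ i, ∑ j, (fderiv ℝ v x (EuclideanSpace.single i 1) j) ^ 2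

/-- The Cauchy–Schwarz inequality for integrals of real functions. -/
theorem sq_integral_mul_le {α : Type*} [MeasurableSpace α] {μ : Measure α} {f g : α → ℝ}
    (hf : Integrable (fun x => f x ^ 2) μ) (hg : Integrable (fun x => g x ^ 2) μ)
    (hfg : Integrable (fun x => f x * g x) μ) :
    (∫ x, f x * g x ∂μ) ^ 2 ≤ (∫ x, f x ^ 2 ∂μ) * ∫ x, g x ^ 2 ∂μ := by
  have h : ∀ t : ℝ, 0 ≤ (∫ x, f x ^ 2 ∂μ) * (t * t) + (2 * ∫ x, f x * g x ∂μ) * t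
      + ∫ x, g x ^ 2 ∂μ := fun t => by
    have h0 : 0 ≤ ∫ x, (t * f x + g x) ^ 2 ∂μ := integral_nonneg fun x => sq_nonneg _
    have h1 : (fun x => (t * f x + g x) ^ 2) =
        fun x => t * t * f x ^ 2 + 2 * t * (f x * g x) + g x ^ 2 := by
      funext x; ring
    have i12 : Integrable (fun x => t * t * f x ^ 2 + 2 * t * (f x * g x)) μ :=
      (hf.const_mul _).add (hfg.const_mul _)
    rw [h1, integral_add i12 hg,
      integral_add (hf.const_mul _) (hfg.const_mul _), integral_const_mul,
      integral_const_mul] at h0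
    linarith
  have := discrim_le_zero h
  rw [discrim] at this
  linarith

section EuclideanFields

variable {d : ℕ}

theorem fderiv_euclidean_coord {U : EuclideanSpace ℝ (Fin d) → EuclideanSpace ℝ (Fin d)}
    {x : EuclideanSpace ℝ (Fin d)} (hU : DifferentiableAt ℝ U x) (i : Fin d)
    (h : EuclideanSpace ℝ (Fin d)) :
    fderiv ℝ (fun y => U y i) x h = fderiv ℝ U x h i := by
  have := ((EuclideanSpace.proj (𝕜 := ℝ) i).hasFDerivAt.comp x hU.hasFDerivAt).fderiv
  exact congrArg (fun L => L h) this

/-- A compactly supported divergence-free field is orthogonal to gradients. -/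
theorem integral_divFree_grad_eq_zero
    {U : EuclideanSpace ℝ (Fin d) → EuclideanSpace ℝ (Fin d)} {φ : EuclideanSpace ℝ (Fin d) → ℝ}
    (hU : ContDiff ℝ 1 U) (hφ : ContDiff ℝ 1 φ) (hUs : HasCompactSupport U)
    (hdiv : ∀ x, ∑ i, fderiv ℝ U x (EuclideanSpace.single i 1) i = 0) :
    ∫ x, ∑ i, U x i * fderiv ℝ φ x (EuclideanSpace.single i 1) = 0 := by
  have cU : ∀ i, Continuous fun x => U x i := fun i => by have := hU.continuous; fun_prop
  have cφ := hφ.continuous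
  have cDφ : ∀ i : Fin d, Continuous fun x => fderiv ℝ φ x (EuclideanSpace.single i 1) :=
    fun i => (hφ.continuous_fderiv one_ne_zero).clm_apply continuous_const
  have cDU : ∀ i : Fin d, Continuous fun x => fderiv ℝ U x (EuclideanSpace.single i 1) i :=
    fun i => by
      have := (hU.continuous_fderiv one_ne_zero).clm_apply
        (continuous_const (y := (EuclideanSpace.single i 1 : EuclideanSpace ℝ (Fin d))))
      fun_prop
  have hint : ∀ f : EuclideanSpace ℝ (Fin d) → ℝ, Continuous f →
      (∀ x, x ∉ tsupport U → f x = 0) → Integrable f := fun f hf h0 =>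
    hf.integrable_of_hasCompactSupport (HasCompactSupport.intro hUs h0)
  have i1 : ∀ i : Fin d,
      Integrable fun x => U x i * fderiv ℝ φ x (EuclideanSpace.single i 1) := fun i =>
    hint _ ((cU i).mul (cDφ i)) fun x hx => by simp [image_eq_zero_of_notMem_tsupport hx]
  have i2 : ∀ i : Fin d,
      Integrable fun x => fderiv ℝ U x (EuclideanSpace.single i 1) i * φ x := fun i =>
    hint _ ((cDU i).mul cφ) fun x hx => by simp [fderiv_of_notMem_tsupport ℝ hx]
  have i3 : ∀ i : Fin d, Integrable fun x => U x i * φ x := fun i =>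
    hint _ ((cU i).mul cφ) fun x hx => by simp [image_eq_zero_of_notMem_tsupport hx]
  have dU : Differentiable ℝ U := hU.differentiable one_ne_zero
  have dUi : ∀ i, Differentiable ℝ fun x => U x i := fun i => by fun_prop
  have parts : ∀ i : Fin d, ∫ x, U x i * fderiv ℝ φ x (EuclideanSpace.single i 1) =
      -∫ x, fderiv ℝ U x (EuclideanSpace.single i 1) i * φ x := fun i => by
    have hc : ∀ x, fderiv ℝ (fun y => U y i) x (EuclideanSpace.single i 1) =
        fderiv ℝ U x (EuclideanSpace.single i 1) i := fun x => fderiv_euclidean_coord (dU x) i _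
    have := integral_mul_fderiv_eq_neg_fderiv_mul_of_integrable (μ := volume)
      (f := fun x => U x i) (g := φ) (v := EuclideanSpace.single i 1)
      (by simpa only [hc] using i2 i) (i1 i) (i3 i) (fun x _ => dUi i x)
      (fun x _ => hφ.differentiable one_ne_zero x)
    simpa only [hc] using this
  rw [integral_finsetSum _ fun i _ => i1 i, Finset.sum_congr rfl fun i _ => parts i,
    Finset.sum_neg_distrib, ← integral_finsetSum _ fun i _ => i2 i]
  simp [← Finset.sum_mul, hdiv]

theorem gradSq_eq_sum_norm_sq (w : EuclideanSpace ℝ (Fin d) → EuclideanSpace ℝ (Fin d))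
    (x : EuclideanSpace ℝ (Fin d)) :
    gradSq d w x = ∑ i, ‖fderiv ℝ w x (EuclideanSpace.single i 1)‖ ^ 2 := by
  simp [gradSq, EuclideanSpace.norm_sq_eq]

theorem gradSq_nonneg (w : EuclideanSpace ℝ (Fin d) → EuclideanSpace ℝ (Fin d))
    (x : EuclideanSpace ℝ (Fin d)) : 0 ≤ gradSq d w x := by
  rw [gradSq_eq_sum_norm_sq]; positivity

theorem continuous_gradSq {w : EuclideanSpace ℝ (Fin d) → EuclideanSpace ℝ (Fin d)}
    (hw : ContDiff ℝ 1 w) : Continuous (gradSq d w) := by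
  rw [funext (gradSq_eq_sum_norm_sq w)]
  exact continuous_finsetSum _ fun i _ =>
    (((hw.continuous_fderiv one_ne_zero).clm_apply continuous_const).norm.pow 2)

theorem norm_fderiv_apply_le (w : EuclideanSpace ℝ (Fin d) → EuclideanSpace ℝ (Fin d))
    (x : EuclideanSpace ℝ (Fin d)) (h : Fin d → ℝ) :
    ‖fderiv ℝ w x (WithLp.toLp 2 h)‖ ≤
      (∑ i, ‖fderiv ℝ w x (EuclideanSpace.single i 1)‖) * ‖h‖ := by
  have hsum : WithLp.toLp 2 h = ∑ i, h i • (EuclideanSpace.single i 1 :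
      EuclideanSpace ℝ (Fin d)) := by
    ext j
    simp [Finset.sum_apply, Pi.single_apply]
  rw [hsum, map_sum, Finset.sum_mul]
  refine norm_sum_le_of_le _ fun i _ => ?_
  rw [map_smul, norm_smul, mul_comm]
  exact mul_le_mul_of_nonneg_left (norm_le_pi_norm h i) (norm_nonneg _)

/-- Pointwise bound for the integrand of the trilinear form. -/
theorem convection_le (w : EuclideanSpace ℝ (Fin d) → EuclideanSpace ℝ (Fin d))
    (x z : EuclideanSpace ℝ (Fin d)) {ν : ℝ} (hν : 0 < ν) :
    ∑ i, ∑ j, w x i * fderiv ℝ w x (EuclideanSpace.single i 1) j * z j ≤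
      ν / 4 * gradSq d w x + 1 / ν * (‖w x‖ ^ 2 * ‖z‖ ^ 2) := by
  have h : ∀ i j, w x i * fderiv ℝ w x (EuclideanSpace.single i 1) j * z j ≤
      ν / 4 * (fderiv ℝ w x (EuclideanSpace.single i 1) j) ^ 2
        + 1 / ν * ((w x i) ^ 2 * (z j) ^ 2) := fun i j => by
    have e : ν / 4 * (fderiv ℝ w x (EuclideanSpace.single i 1) j) ^ 2
        + 1 / ν * ((w x i) ^ 2 * (z j) ^ 2)
        - w x i * fderiv ℝ w x (EuclideanSpace.single i 1) j * z j =
        1 / ν * (ν / 2 * fderiv ℝ w x (EuclideanSpace.single i 1) j - w x i * z j) ^ 2 := by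
      field_simp
      ring
    have : 0 ≤ 1 / ν * (ν / 2 * fderiv ℝ w x (EuclideanSpace.single i 1) j - w x i * z j) ^ 2 := by
      positivity
    linarith
  refine (Finset.sum_le_sum fun i _ => Finset.sum_le_sum fun j _ => h i j).trans_eq ?_
  simp only [gradSq, EuclideanSpace.norm_sq_eq, Real.norm_eq_abs, sq_abs, Finset.sum_add_distrib,
    Finset.mul_sum, Finset.sum_mul]
  congr 1
  rw [Finset.sum_comm]

end EuclideanFields

/-- Ladyzhenskaya's inequality in the plane. -/
theorem ladyzhenskaya {w : EuclideanSpace ℝ (Fin 2) → EuclideanSpace ℝ (Fin 2)}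
    (hw : ContDiff ℝ 1 w) (hws : HasCompactSupport w) :
    ∫ x, ‖w x‖ ^ 4 ≤ 8 * (∫ x, ‖w x‖ ^ 2) * ∫ x, gradSq 2 w x := by
  set S : EuclideanSpace ℝ (Fin 2) → ℝ :=
    fun x => ∑ i, ‖fderiv ℝ w x (EuclideanSpace.single i 1)‖ with hS
  have cw := hw.continuous
  have cS : Continuous S := continuous_finsetSum _ fun i _ =>
    ((hw.continuous_fderiv one_ne_zero).clm_apply continuous_const).norm
  have S0 : ∀ x, 0 ≤ S x := fun x => Finset.sum_nonneg fun i _ => norm_nonneg _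
  have hint : ∀ f : EuclideanSpace ℝ (Fin 2) → ℝ, Continuous f →
      (∀ x, x ∉ tsupport w → f x = 0) → Integrable f := fun f hf h0 =>
    hf.integrable_of_hasCompactSupport (HasCompactSupport.intro hws h0)
  have w0 : ∀ x, x ∉ tsupport w → w x = 0 := fun x hx => image_eq_zero_of_notMem_tsupport hx
  have Sz : ∀ x, x ∉ tsupport w → S x = 0 := fun x hx => by
    simp [hS, fderiv_of_notMem_tsupport ℝ hx]
  have i4 : Integrable fun x => ‖w x‖ ^ 4 := hint _ (by fun_prop) fun x hx => by simp [w0 x hx]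
  have i2 : Integrable fun x => ‖w x‖ ^ 2 := hint _ (by fun_prop) fun x hx => by simp [w0 x hx]
  have iS2 : Integrable fun x => S x ^ 2 := hint _ (by fun_prop) fun x hx => by simp [Sz x hx]
  have iwS : Integrable fun x => ‖w x‖ * S x :=
    hint _ (by fun_prop) fun x hx => by simp [Sz x hx]
  have iG : Integrable (gradSq 2 w) := hint _ (continuous_gradSq hw) fun x hx => by
    simp [gradSq, fderiv_of_notMem_tsupport ℝ hx]
  let T : (Fin 2 → ℝ) ≃L[ℝ] EuclideanSpace ℝ (Fin 2) :=
    (EuclideanSpace.equiv (Fin 2) ℝ).symm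
  have hT : ∀ y, T y = WithLp.toLp 2 y := fun y => rfl
  have key : ∫⁻ y : Fin 2 → ℝ, ‖‖w (T y)‖ ^ 2‖ₑ ^ (2 : ℝ) ≤
      (∫⁻ y : Fin 2 → ℝ, ‖fderiv ℝ (fun y => ‖w (T y)‖ ^ 2) y‖ₑ) ^ (2 : ℝ) := by
    refine lintegral_pow_le_pow_lintegral_fderiv_aux (p := 2) ?_ ?_ ?_
    · simpa using Real.HolderConjugate.two_two
    · exact (hw.comp T.contDiff).norm_sq ℝ
    · refine HasCompactSupport.intro (K := T ⁻¹' tsupport w)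
        (T.toHomeomorph.isCompact_preimage.2 hws) fun y hy => ?_
      simp [w0 (T y) hy]
  have hder : ∀ y, ‖fderiv ℝ (fun y => ‖w (T y)‖ ^ 2) y‖ ≤ 2 * (‖w (T y)‖ * S (T y)) := fun y => by
    have hd := (((hw.differentiable one_ne_zero (T y)).hasFDerivAt.comp y
      T.hasFDerivAt).norm_sq).fderiv
    have hd' : fderiv ℝ (fun y => ‖w (T y)‖ ^ 2) y = _ := hd
    rw [hd']
    refine ContinuousLinearMap.opNorm_le_bound _
      (mul_nonneg zero_le_two (mul_nonneg (norm_nonneg _) (S0 _))) fun h => ?_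
    have h1 := norm_inner_le_norm (𝕜 := ℝ) (w (T y)) (fderiv ℝ w (T y) (T h))
    have h2 := norm_fderiv_apply_le w (T y) h
    have h3 : ‖w (T y)‖ * ‖fderiv ℝ w (T y) (T h)‖ ≤ ‖w (T y)‖ * (S (T y) * ‖h‖) :=
      mul_le_mul_of_nonneg_left h2 (norm_nonneg _)
    have h4 := h1.trans h3
    simp only [Real.norm_eq_abs] at h4
    simp
    linarith
  have mp := PiLp.volume_preserving_toLp (Fin 2)
  have emb : MeasurableEmbedding (WithLp.toLp 2 : (Fin 2 → ℝ) → EuclideanSpace ℝ (Fin 2)) :=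
    (MeasurableEquiv.toLp 2 (Fin 2 → ℝ)).measurableEmbedding
  have hL : ∫⁻ y : Fin 2 → ℝ, ‖‖w (T y)‖ ^ 2‖ₑ ^ (2 : ℝ) =
      ENNReal.ofReal (∫ x, ‖w x‖ ^ 4) := by
    rw [ofReal_integral_eq_lintegral_ofReal i4 (ae_of_all _ fun x => by positivity),
      ← mp.lintegral_comp_emb emb]
    refine lintegral_congr fun y => ?_
    rw [hT, Real.enorm_eq_ofReal (by positivity),
      ENNReal.ofReal_rpow_of_nonneg (by positivity) (by norm_num)]
    congr 1
    norm_cast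
    ring
  have hR : ∫⁻ y : Fin 2 → ℝ, ‖fderiv ℝ (fun y => ‖w (T y)‖ ^ 2) y‖ₑ ≤
      ENNReal.ofReal (∫ x, 2 * (‖w x‖ * S x)) := by
    rw [ofReal_integral_eq_lintegral_ofReal (iwS.const_mul 2)
      (ae_of_all _ fun x => mul_nonneg zero_le_two (mul_nonneg (norm_nonneg _) (S0 _))),
      ← mp.lintegral_comp_emb emb]
    refine lintegral_mono fun y => ?_
    rw [← ofReal_norm]
    exact ENNReal.ofReal_le_ofReal (hder y)
  have hA0 : 0 ≤ ∫ x, ‖w x‖ * S x :=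
    integral_nonneg fun x => mul_nonneg (norm_nonneg _) (S0 x)
  have main : ∫ x, ‖w x‖ ^ 4 ≤ (2 * ∫ x, ‖w x‖ * S x) ^ 2 := by
    rw [integral_const_mul] at hR
    have := key.trans (ENNReal.rpow_le_rpow hR zero_le_two)
    rw [hL, ENNReal.ofReal_rpow_of_nonneg (by positivity) (by norm_num),
      ENNReal.ofReal_le_ofReal_iff (by positivity)] at this
    exact_mod_cast this
  have cs := sq_integral_mul_le i2 iS2 iwS
  have hSG : ∫ x, S x ^ 2 ≤ 2 * ∫ x, gradSq 2 w x := by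
    rw [← integral_const_mul]
    refine integral_mono iS2 (iG.const_mul 2) fun x => ?_
    simp only [hS, gradSq_eq_sum_norm_sq, Fin.sum_univ_two]
    nlinarith [sq_nonneg (‖fderiv ℝ w x (EuclideanSpace.single 0 1)‖ -
      ‖fderiv ℝ w x (EuclideanSpace.single 1 1)‖)]
  have hH0 : 0 ≤ ∫ x, ‖w x‖ ^ 2 := integral_nonneg fun x => by positivity
  nlinarith [mul_le_mul_of_nonneg_left hSG hH0]

/-- Local monotonicity for 2-D Navier–Stokes:
`⟨Au + F(u) - Av - F(v), u - v⟩ ≤ -(ν/2)‖u-v‖_V² + (32/ν³)‖v‖_{L⁴}⁴ ‖u-v‖_H²`,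
where `⟨Aw, z⟩ = -ν ∫ ∇w·∇z` and `⟨F(w), z⟩ = -b(w,w,z)`. -/
theorem ns2d_local_monotonicity
    (Λ : Set (EuclideanSpace ℝ (Fin 2))) (hΛo : IsOpen Λ)
    (hΛb : Bornology.IsBounded Λ)
    (ν : ℝ) (hν : 0 < ν)
    (u v : EuclideanSpace ℝ (Fin 2) → EuclideanSpace ℝ (Fin 2))
    (hu : ContDiff ℝ 1 u) (hv : ContDiff ℝ 1 v)
    (hus : tsupport u ⊆ Λ) (hvs : tsupport v ⊆ Λ)
    (hudiv : ∀ x, ∑ i, fderiv ℝ u x (EuclideanSpace.single i 1) i = 0)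
    (hvdiv : ∀ x, ∑ i, fderiv ℝ v x (EuclideanSpace.single i 1) i = 0) :
    -ν * (∫ x, gradSq 2 (u - v) x) - nsTrilinear 2 u u (u - v)
        + nsTrilinear 2 v v (u - v) ≤
      -(ν/2) * (∫ x, gradSq 2 (u - v) x) +
        (32/ν^3) * (∫ x, ‖v x‖ ^ 4) * ∫ x, ‖u x - v x‖ ^ 2 := by
  set w := u - v with hwdef
  have hw : ContDiff ℝ 1 w := hu.sub hv
  have cΛ : IsCompact (closure Λ) := hΛb.isCompact_closure
  have hcu : HasCompactSupport u :=
    cΛ.of_isClosed_subset (isClosed_tsupport u) (hus.trans subset_closure)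
  have hcv : HasCompactSupport v :=
    cΛ.of_isClosed_subset (isClosed_tsupport v) (hvs.trans subset_closure)
  have hcw : HasCompactSupport w := hcu.sub hcv
  have du : Differentiable ℝ u := hu.differentiable one_ne_zero
  have dv : Differentiable ℝ v := hv.differentiable one_ne_zero
  have dw : Differentiable ℝ w := hw.differentiable one_ne_zero
  have hDw : ∀ x h, fderiv ℝ w x h = fderiv ℝ u x h - fderiv ℝ v x h := fun x h => by
    rw [hwdef, fderiv_sub (du x) (dv x)]; rfl
  have hwdiv : ∀ x, ∑ i, fderiv ℝ w x (EuclideanSpace.single i 1) i = 0 := fun x => by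
    simp [hDw, Finset.sum_sub_distrib, hudiv, hvdiv]
  have cu := hu.continuous
  have cv := hv.continuous
  have cw := hw.continuous
  have cD : ∀ f : EuclideanSpace ℝ (Fin 2) → EuclideanSpace ℝ (Fin 2), ContDiff ℝ 1 f →
      ∀ i : Fin 2, Continuous fun x => fderiv ℝ f x (EuclideanSpace.single i 1) := fun f hf i =>
    (hf.continuous_fderiv one_ne_zero).clm_apply continuous_const
  have iw : ∀ f : EuclideanSpace ℝ (Fin 2) → ℝ, Continuous f →
      (∀ x, w x = 0 → f x = 0) → Integrable f := fun f hf h0 =>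
    hf.integrable_of_hasCompactSupport (HasCompactSupport.intro hcw fun x hx =>
      h0 x (image_eq_zero_of_notMem_tsupport hx))
  have iv : ∀ f : EuclideanSpace ℝ (Fin 2) → ℝ, Continuous f →
      (∀ x, v x = 0 → f x = 0) → Integrable f := fun f hf h0 =>
    hf.integrable_of_hasCompactSupport (HasCompactSupport.intro hcv fun x hx =>
      h0 x (image_eq_zero_of_notMem_tsupport hx))
  have iu : ∀ f : EuclideanSpace ℝ (Fin 2) → ℝ, Continuous f →
      (∀ x, u x = 0 → f x = 0) → Integrable f := fun f hf h0 =>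
    hf.integrable_of_hasCompactSupport (HasCompactSupport.intro hcu fun x hx =>
      h0 x (image_eq_zero_of_notMem_tsupport hx))
  have cT : ∀ f g k : EuclideanSpace ℝ (Fin 2) → EuclideanSpace ℝ (Fin 2), Continuous f →
      ContDiff ℝ 1 g → Continuous k → Continuous fun x =>
        ∑ i, ∑ j, f x i * fderiv ℝ g x (EuclideanSpace.single i 1) j * k x j :=
    fun f g k hf hg hk => continuous_finsetSum _ fun i _ => continuous_finsetSum _ fun j _ => by
      have := cD g hg i
      fun_prop
  have iuuw := iu _ (cT u u w cu hu cw) fun x hx => by simp [hx]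
  have ivvw := iv _ (cT v v w cv hv cw) fun x hx => by simp [hx]
  have iwwv := iw _ (cT w w v cw hw cv) fun x hx => by simp [hx]
  have hφ : ContDiff ℝ 1 fun x => inner ℝ (w x) (w x) := hw.inner ℝ hw
  have hψ : ContDiff ℝ 1 fun x => inner ℝ (w x) (v x) := hw.inner ℝ hv
  have o1 := integral_divFree_grad_eq_zero hu hφ hcu hudiv
  have o2 := integral_divFree_grad_eq_zero hw hψ hcw hwdiv
  have io1 : Integrable fun x => ∑ i, u x i *
      fderiv ℝ (fun x => inner ℝ (w x) (w x)) x (EuclideanSpace.single i 1) :=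
    iu _ (continuous_finsetSum _ fun i _ => by
      have : Continuous fun x => fderiv ℝ (fun x => inner ℝ (w x) (w x)) x
          (EuclideanSpace.single i 1) :=
        (hφ.continuous_fderiv one_ne_zero).clm_apply continuous_const
      fun_prop) fun x hx => by simp [hx]
  have io2 : Integrable fun x => ∑ i, w x i *
      fderiv ℝ (fun x => inner ℝ (w x) (v x)) x (EuclideanSpace.single i 1) :=
    iw _ (continuous_finsetSum _ fun i _ => by
      have : Continuous fun x => fderiv ℝ (fun x => inner ℝ (w x) (v x)) x
          (EuclideanSpace.single i 1) :=
        (hψ.continuous_fderiv one_ne_zero).clm_apply continuous_const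
      fun_prop) fun x hx => by simp [hx]
  have cancel : nsTrilinear 2 v v w - nsTrilinear 2 u u w = nsTrilinear 2 w w v := by
    have hpt : ∀ x,
        (∑ i, ∑ j, v x i * fderiv ℝ v x (EuclideanSpace.single i 1) j * w x j)
          - (∑ i, ∑ j, u x i * fderiv ℝ u x (EuclideanSpace.single i 1) j * w x j)
          + 1 / 2 * (∑ i, u x i *
            fderiv ℝ (fun x => inner ℝ (w x) (w x)) x (EuclideanSpace.single i 1))
          + (∑ i, w x i *
            fderiv ℝ (fun x => inner ℝ (w x) (v x)) x (EuclideanSpace.single i 1)) =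
        ∑ i, ∑ j, w x i * fderiv ℝ w x (EuclideanSpace.single i 1) j * v x j := fun x => by
      have hwx : ∀ i, w x i = u x i - v x i := fun i => rfl
      simp only [fderiv_inner_apply ℝ (dw x) (dw x), fderiv_inner_apply ℝ (dw x) (dv x)]
      simp only [PiLp.inner_apply, RCLike.inner_apply, conj_trivial, hDw, PiLp.sub_apply, hwx,
        Fin.sum_univ_two]
      ring
    have hsub := ivvw.sub iuuw
    have hadd := hsub.add (io1.const_mul (1 / 2))
    have hI := integral_congr_ae (μ := volume) (ae_of_all _ hpt)
    have e1 := integral_add hadd io2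
    have e2 := integral_add hsub (io1.const_mul (1 / 2))
    have e3 := integral_sub ivvw iuuw
    simp only [Pi.add_apply, Pi.sub_apply] at e1 e2 e3
    rw [e1, e2, e3,
      integral_const_mul, o1, o2] at hI
    simpa only [nsTrilinear, mul_zero, add_zero] using hI
  have iG : Integrable (gradSq 2 w) :=
    (continuous_gradSq hw).integrable_of_hasCompactSupport (HasCompactSupport.intro hcw
      fun x hx => by simp [gradSq, fderiv_of_notMem_tsupport ℝ hx])
  have iwv : Integrable fun x => ‖w x‖ ^ 2 * ‖v x‖ ^ 2 :=
    iw _ (by fun_prop) fun x hx => by simp [hx]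
  have bound : nsTrilinear 2 w w v ≤ ν / 4 * (∫ x, gradSq 2 w x)
      + 1 / ν * ∫ x, ‖w x‖ ^ 2 * ‖v x‖ ^ 2 := by
    rw [← integral_const_mul, ← integral_const_mul,
      ← integral_add (iG.const_mul _) (iwv.const_mul _)]
    exact integral_mono iwwv ((iG.const_mul _).add (iwv.const_mul _)) fun x =>
      convection_le w x (v x) hν
  have cs := sq_integral_mul_le (μ := volume) (f := fun x => ‖w x‖ ^ 2) (g := fun x => ‖v x‖ ^ 2)
    (iw _ (by fun_prop) fun x hx => by simp [hx]) (iv _ (by fun_prop) fun x hx => by simp [hx]) iwv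
  simp only [← pow_mul, Nat.reduceMul] at cs
  have lad := ladyzhenskaya hw hcw
  have hG0 : 0 ≤ ∫ x, gradSq 2 w x := integral_nonneg (gradSq_nonneg w)
  have hH0 : 0 ≤ ∫ x, ‖w x‖ ^ 2 := integral_nonneg fun x => by positivity
  have hL0 : 0 ≤ ∫ x, ‖v x‖ ^ 4 := integral_nonneg fun x => by positivity
  have hHw : ∫ x, ‖u x - v x‖ ^ 2 = ∫ x, ‖w x‖ ^ 2 := rfl
  rw [hHw]
  generalize (∫ x, gradSq 2 w x) = G at *
  generalize (∫ x, ‖w x‖ ^ 2) = H at *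
  generalize (∫ x, ‖v x‖ ^ 4) = L at *
  generalize (∫ x, ‖w x‖ ^ 2 * ‖v x‖ ^ 2) = K at *
  have hK2 : K ^ 2 ≤ 8 * H * G * L := cs.trans (mul_le_mul_of_nonneg_right lad hL0)
  have hK : K ≤ ν ^ 2 / 4 * G + 8 / ν ^ 2 * (H * L) := by
    refine le_of_sq_le_sq (hK2.trans ?_) (by positivity)
    have e : (ν ^ 2 / 4 * G + 8 / ν ^ 2 * (H * L)) ^ 2 - 8 * H * G * L =
        (ν ^ 2 / 4 * G - 8 / ν ^ 2 * (H * L)) ^ 2 := by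
      field_simp
      ring
    linarith [sq_nonneg (ν ^ 2 / 4 * G - 8 / ν ^ 2 * (H * L))]
  have hKν : 1 / ν * K ≤ ν / 4 * G + 8 / ν ^ 3 * (H * L) := by
    refine (mul_le_mul_of_nonneg_left hK (by positivity)).trans_eq ?_
    field_simp
  have hrest : 8 / ν ^ 3 * (H * L) ≤ 32 / ν ^ 3 * L * H := by
    have : 0 ≤ 24 / ν ^ 3 * (H * L) := by positivity
    have e : 32 / ν ^ 3 * L * H = 8 / ν ^ 3 * (H * L) + 24 / ν ^ 3 * (H * L) := by ring
    linarith
  linarith
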